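/- arXiv:1902.10187 — 2 statements merged into one kernel-verified Lean document; each statement's English description precedes it below -/
import Mathlib

section
/- Let Ω ⊆ ℝ^n be a measurable set and let x ∈ Ω ↦ ν_x be a measurable family of Borel probability measures on ℝ^m (a Young measure) such that, for some r > 0, ∫_{ℝ^m} ‖ξ‖^r dν_x(ξ) < ∞ for almost every x ∈ Ω. Then, taking the probability space to be the interval [0,1) with the Borel σ-algebra and Lebesgue measure, there exists a jointly (Borel) measurable function u : [0,1) × Ω → ℝ^m whose law is ν, i.e., for almost every x ∈ Ω the pushforward of Lebesgue measure on [0,1) under ω ↦ u(ω, x) equals ν_x. -/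
open MeasureTheory

/-- A measurable family of measures that are probability measures on a measurable set `s`
agrees on `s` with a Markov kernel. -/
lemma exists_isMarkovKernel_eqOn {X Y : Type*} [MeasurableSpace X] [MeasurableSpace Y] [Nonempty Y]
    {s : Set X} (hs : MeasurableSet s) {ν : X → Measure Y} (hν : Measurable ν)
    (h_prob : ∀ x ∈ s, IsProbabilityMeasure (ν x)) :
    ∃ κ : ProbabilityTheory.Kernel X Y,
      ProbabilityTheory.IsMarkovKernel κ ∧ Set.EqOn κ ν s := by
  classical
  obtain ⟨y⟩ := ‹Nonempty Y›
  refine ⟨⟨s.piecewise ν fun _ => Measure.dirac y, hν.piecewise hs measurable_const⟩,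
    ⟨fun x => ?_⟩, fun x hx => Set.piecewise_eq_of_mem s ν (fun _ => Measure.dirac y) hx⟩
  change IsProbabilityMeasure (s.piecewise ν (fun _ => Measure.dirac y) x)
  by_cases hx : x ∈ s
  · rw [Set.piecewise_eq_of_mem _ _ _ hx]
    exact h_prob x hx
  · rw [Set.piecewise_eq_of_notMem _ _ _ hx]
    infer_instance

/-- Projecting Lebesgue measure on `[0,1)` to the closed unit interval gives the uniform measure. -/
lemma map_projIcc_volume_restrict_Ico :
    (volume.restrict (Set.Ico (0 : ℝ) 1)).map (Set.projIcc 0 1 zero_le_one) =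
      (volume : Measure unitInterval) := by
  have h : (volume : Measure unitInterval).map Subtype.val = volume.restrict (Set.Icc (0 : ℝ) 1) :=
    map_comap_subtype_coe measurableSet_Icc volume
  rw [Measure.restrict_congr_set Ico_ae_eq_Icc, ← h,
    Measure.map_map continuous_projIcc.measurable measurable_subtype_coe]
  convert Measure.map_id
  ext x
  simp

/-- Given a Young measure `(ν_x)_{x ∈ Ω}` on `ℝ^m` (a measurably parameterized family of Borel
probability measures) with finite `r`-th moments a.e., there exists a jointly Borel measurable
function `u : [0,1) × Ω → ℝ^m`, on the probability space `[0,1)` with Lebesgue measure,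
whose law is `ν`: for a.e. `x ∈ Ω` the pushforward of Lebesgue measure on `[0,1)` under
`ω ↦ u(ω, x)` equals `ν_x`. -/
theorem young_measure_has_representing_random_field
    (n m : ℕ) (r : ℝ) (hr : 0 < r)
    (Ω : Set (Fin n → ℝ)) (hΩ : MeasurableSet Ω)
    (ν : (Fin n → ℝ) → Measure (Fin m → ℝ))
    (h_prob : ∀ x ∈ Ω, IsProbabilityMeasure (ν x))
    (h_meas : ∀ B : Set (Fin m → ℝ), MeasurableSet B → Measurable (fun x => ν x B))
    (h_mom : ∀ᵐ x ∂(volume.restrict Ω), ∫⁻ ξ, ENNReal.ofReal (‖ξ‖ ^ r) ∂(ν x) < ⊤) :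
    ∃ u : ℝ → (Fin n → ℝ) → (Fin m → ℝ),
      Measurable (fun p : ℝ × (Fin n → ℝ) => u p.1 p.2) ∧
      ∀ᵐ x ∂(volume.restrict Ω),
        (volume.restrict (Set.Ico (0 : ℝ) 1)).map (fun ω => u ω x) = ν x := by
  obtain ⟨κ, _, hκν⟩ := exists_isMarkovKernel_eqOn hΩ
    (Measure.measurable_of_measurable_coe ν h_meas) h_prob
  obtain ⟨f, hf, hfκ⟩ := κ.exists_measurable_map_eq_unitInterval
  have hproj : Measurable (Set.projIcc (0 : ℝ) 1 zero_le_one) := continuous_projIcc.measurable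
  refine ⟨fun ω x => f x (Set.projIcc 0 1 zero_le_one ω),
    hf.comp (measurable_snd.prodMk (hproj.comp measurable_fst)), ?_⟩
  filter_upwards [ae_restrict_mem hΩ] with x hx
  rw [← hκν hx, ← hfκ x, ← map_projIcc_volume_restrict_Ico,
    Measure.map_map hf.of_uncurry_left hproj]
  rfl
end

section
/- Let K : ℝ³ → ℝ be the stability function defined by K(ξ) = (ξ₁² + ξ₂²)^{3/2} / (ξ₁² + ξ₂² + ξ₃) if ξ₃ > 0, and K(ξ) = √(ξ₁² + ξ₂² − ξ₃) if ξ₃ ≤ 0, and let a(ξ) = K(ξ)ξ. Then a fails to be coercive in the region ξ₃ > 0: along the curve ξ(s) = (1, 0, s), s > 0, one has a(ξ(s)) · ξ(s) / ‖ξ(s)‖ → 1 as s → +∞, where ‖·‖ is the Euclidean norm on ℝ³. -/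
/-- `√(1 + s²) ~ 1 + s` as `s → +∞`. -/
theorem tendsto_sqrt_one_add_sq_div_one_add :
    Filter.Tendsto (fun s : ℝ => Real.sqrt (1 + s ^ 2) / (1 + s)) Filter.atTop (nhds 1) := by
  have hlow : Filter.Tendsto (fun s : ℝ => 1 - (1 + s)⁻¹) Filter.atTop (nhds 1) := by
    have h := (tendsto_inv_atTop_zero (𝕜 := ℝ)).comp
      (Filter.tendsto_atTop_add_const_left Filter.atTop (1 : ℝ) Filter.tendsto_id)
    simpa using h.const_sub 1
  refine tendsto_of_tendsto_of_tendsto_of_le_of_le' hlow tendsto_const_nhds ?_ ?_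
  · filter_upwards [Filter.eventually_gt_atTop 0] with s hs
    have hs' : 0 < 1 + s := by linarith
    rw [le_div_iff₀ hs', sub_mul, inv_mul_cancel₀ hs'.ne']
    exact Real.le_sqrt_of_sq_le (by nlinarith)
  · filter_upwards [Filter.eventually_gt_atTop 0] with s hs
    have hs' : 0 < 1 + s := by linarith
    rw [div_le_one hs']
    exact Real.sqrt_le_iff.mpr ⟨hs'.le, by nlinarith⟩

/-- The nonlinearity `a(ξ) = K(ξ)ξ`, where `K` is the stability function of the atmospheric
boundary layer model, fails to be coercive in the region `ξ₃ > 0`: along the curve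
`ξ(s) = (1, 0, s)`, `s > 0`, one has `a(ξ(s)) · ξ(s) / ‖ξ(s)‖ → 1` as `s → +∞`,
where `‖·‖` is the Euclidean norm on `ℝ³`. -/
theorem stability_nonlinearity_not_coercive
    (K : EuclideanSpace ℝ (Fin 3) → ℝ)
    (hK : ∀ ξ : EuclideanSpace ℝ (Fin 3), K ξ =
      if 0 < ξ 2 then
        ((ξ 0) ^ 2 + (ξ 1) ^ 2) ^ ((3 : ℝ) / 2) / ((ξ 0) ^ 2 + (ξ 1) ^ 2 + ξ 2)
      else
        Real.sqrt ((ξ 0) ^ 2 + (ξ 1) ^ 2 - ξ 2))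
    (a : EuclideanSpace ℝ (Fin 3) → EuclideanSpace ℝ (Fin 3))
    (ha : ∀ ξ, a ξ = K ξ • ξ)
    (ξ : ℝ → EuclideanSpace ℝ (Fin 3))
    (hξ : ∀ s : ℝ, ξ s = ![1, 0, s]) :
    Filter.Tendsto (fun s : ℝ => (∑ i, a (ξ s) i * ξ s i) / ‖ξ s‖)
      Filter.atTop (nhds 1) := by
  refine tendsto_sqrt_one_add_sq_div_one_add.congr' ?_
  filter_upwards [Filter.eventually_gt_atTop 0] with s hs
  have h0 : ξ s 0 = 1 := by simp [hξ]
  have h1 : ξ s 1 = 0 := by simp [hξ]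
  have h2 : ξ s 2 = s := by simp [hξ]
  have hnorm : ‖ξ s‖ = Real.sqrt (1 + s ^ 2) := by
    simp [EuclideanSpace.norm_eq, Fin.sum_univ_three, h0, h1, h2]
  have hKs : K (ξ s) = 1 / (1 + s) := by
    rw [hK, h0, h1, h2, if_pos hs]
    norm_num
  have hsum : ∑ i, a (ξ s) i * ξ s i = 1 / (1 + s) * (1 + s ^ 2) := by
    simp only [ha, hKs, Fin.sum_univ_three, PiLp.smul_apply, smul_eq_mul, h0, h1, h2]
    ring
  rw [hsum, hnorm, mul_div_assoc, Real.div_sqrt]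
  ring
end
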